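/- arXiv:2410.02814 — 6 statements merged into one kernel-verified Lean document; each statement's English description precedes it below -/
import Mathlib

section
/- For m ∈ ℕ ∪ {0}, define h_m : [0,1] → ℝ by h_m(x) = ((2⌊2^m x⌋ + 1)/2^m)·(x − ⌊2^m x⌋/2^m) + (⌊2^m x⌋/2^m)². Then for every m ∈ ℕ ∪ {0} and every x ∈ [0,1], h_m(x) − h_{m+1}(x) = g^{m+1}(x) / 2^{2(m+1)}. -/
/-- The sawtooth function g(x) = min{2x, 2 − 2x} (on [0,1]). -/
noncomputable def sawtooth (x : ℝ) : ℝ := min (2 * x) (2 - 2 * x)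

/-- The piecewise linear interpolation h_m of the square function on dyadic intervals. -/
noncomputable def hInterp (m : ℕ) (x : ℝ) : ℝ :=
  (2 * (⌊(2 : ℝ) ^ m * x⌋ : ℝ) + 1) / 2 ^ m * (x - (⌊(2 : ℝ) ^ m * x⌋ : ℝ) / 2 ^ m) +
    ((⌊(2 : ℝ) ^ m * x⌋ : ℝ) / 2 ^ m) ^ 2

lemma floor_two_mul_cases (y : ℝ) :
    (⌊2 * y⌋ = 2 * ⌊y⌋ ∧ y - ⌊y⌋ < 1 / 2) ∨ (⌊2 * y⌋ = 2 * ⌊y⌋ + 1 ∧ 1 / 2 ≤ y - ⌊y⌋) := by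
  have h1 := Int.floor_le y
  have h2 := Int.lt_floor_add_one y
  rcases lt_or_ge (y - ⌊y⌋) (1 / 2) with h | h
  · left
    refine ⟨?_, h⟩
    rw [Int.floor_eq_iff]
    push_cast
    constructor <;> linarith
  · right
    refine ⟨?_, h⟩
    rw [Int.floor_eq_iff]
    push_cast
    constructor <;> linarith

lemma sawtooth_symm (t : ℝ) : sawtooth (1 - t) = sawtooth t := by
  unfold sawtooth
  rw [min_comm]
  congr 1 <;> ring

lemma sawtooth_left {t : ℝ} (h : t ≤ 1 / 2) : sawtooth t = 2 * t := by
  unfold sawtooth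
  exact min_eq_left (by linarith)

lemma sawtooth_right {t : ℝ} (h : 1 / 2 ≤ t) : sawtooth t = 2 - 2 * t := by
  unfold sawtooth
  exact min_eq_right (by linarith)

lemma sawtooth_iter (m : ℕ) (x : ℝ) (hx : x ∈ Set.Icc (0 : ℝ) 1) :
    sawtooth^[m + 1] x = sawtooth ((2 : ℝ) ^ m * x - ⌊(2 : ℝ) ^ m * x⌋) := by
  induction m with
  | zero =>
    rcases hx.2.lt_or_eq with h | h
    · have : ⌊x⌋ = 0 := Int.floor_eq_zero_iff.2 ⟨hx.1, h⟩
      simp [this]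
    · subst h
      simp [sawtooth]
  | succ m ih =>
    rw [Function.iterate_succ_apply', ih, pow_succ', mul_assoc]
    generalize (2 : ℝ) ^ m * x = y
    rcases floor_two_mul_cases y with ⟨h, ht⟩ | ⟨h, ht⟩
    · rw [sawtooth_left ht.le, h]
      push_cast
      congr 1
      ring
    · rw [sawtooth_right ht, h, ← sawtooth_symm]
      push_cast
      congr 1
      ring

lemma hInterp_eq (m : ℕ) (x : ℝ) : hInterp m x =
    ((2 * (⌊(2 : ℝ) ^ m * x⌋ : ℝ) + 1) * ((2 : ℝ) ^ m * x - ⌊(2 : ℝ) ^ m * x⌋) +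
      (⌊(2 : ℝ) ^ m * x⌋ : ℝ) ^ 2) / ((2 : ℝ) ^ m) ^ 2 := by
  unfold hInterp
  generalize (⌊(2 : ℝ) ^ m * x⌋ : ℝ) = n
  field_simp

/-- for every m ∈ ℕ ∪ {0} and x ∈ [0,1],
h_m(x) − h_{m+1}(x) = g^{m+1}(x)/2^{2(m+1)}. -/
theorem stmt_4 (m : ℕ) (x : ℝ) (hx : x ∈ Set.Icc (0 : ℝ) 1) :
    hInterp m x - hInterp (m + 1) x = sawtooth^[m + 1] x / 2 ^ (2 * (m + 1)) := by
  rw [sawtooth_iter m x hx, hInterp_eq, hInterp_eq]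
  have e : (2 : ℝ) ^ (2 * (m + 1)) = 4 * ((2 : ℝ) ^ m) ^ 2 := by ring
  rw [e, pow_succ' (2 : ℝ) m, mul_assoc 2 ((2 : ℝ) ^ m) x]
  have hp : (2 : ℝ) ^ m ≠ 0 := by positivity
  generalize (2 : ℝ) ^ m * x = y
  generalize (2 : ℝ) ^ m = p at hp
  rcases floor_two_mul_cases y with ⟨h, ht⟩ | ⟨h, ht⟩
  · rw [sawtooth_left ht.le, h]
    push_cast
    field_simp
    ring
  · rw [sawtooth_right ht, h]
    push_cast
    field_simp
    ring
end

section
/- For every m ∈ ℕ, sup_{x ∈ [0,1]} |x² − f_m(x)| = 2^{−2(m+1)}, where f_m(x) = x − Σ_{k=1}^m g^k(x)/2^{2k}. -/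
/-- f_m(x) = x − Σ_{k=1}^m g^k(x)/2^{2k}. -/
noncomputable def fApprox (m : ℕ) (x : ℝ) : ℝ :=
  x - ∑ k ∈ Finset.Icc 1 m, sawtooth^[k] x / 2 ^ (2 * k)

theorem saw_key (y : ℝ) : y - y ^ 2 = sawtooth y / 4 + (sawtooth y - sawtooth y ^ 2) / 4 := by
  unfold sawtooth
  rcases min_choice (2 * y) (2 - 2 * y) with h | h <;> rw [h] <;> ring

theorem fApprox_sub (m : ℕ) (x : ℝ) :
    fApprox m x - x ^ 2 = (sawtooth^[m] x - (sawtooth^[m] x) ^ 2) / 2 ^ (2 * m) := by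
  induction m with
  | zero => simp [fApprox]
  | succ n ih =>
    have h1 : fApprox (n + 1) x = fApprox n x - sawtooth^[n + 1] x / 2 ^ (2 * (n + 1)) := by
      unfold fApprox
      rw [Finset.sum_Icc_succ_top (by omega)]
      ring
    have h2 : fApprox (n + 1) x - x ^ 2
        = (fApprox n x - x ^ 2) - sawtooth^[n + 1] x / 2 ^ (2 * (n + 1)) := by rw [h1]; ring
    rw [h2, ih, saw_key (sawtooth^[n] x), Function.iterate_succ_apply', mul_add, pow_add]
    field_simp
    ring

theorem saw_mem (m : ℕ) (x : ℝ) (hx : x ∈ Set.Icc (0 : ℝ) 1) :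
    sawtooth^[m] x ∈ Set.Icc (0 : ℝ) 1 := by
  induction m with
  | zero => simpa using hx
  | succ n ih =>
    rw [Function.iterate_succ_apply']
    obtain ⟨h0, h1⟩ := ih
    generalize sawtooth^[n] x = y at *
    unfold sawtooth
    constructor
    · apply le_min <;> linarith
    · rcases le_total (2 * y) 1 with h | h
      · exact (min_le_left _ _).trans h
      · exact (min_le_right _ _).trans (by linarith)

theorem saw_half (m : ℕ) : sawtooth^[m] (1 / 2 ^ (m + 1)) = 1 / 2 := by
  induction m with
  | zero => simp
  | succ n ih =>
    rw [Function.iterate_succ_apply]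
    have : sawtooth (1 / 2 ^ (n + 1 + 1)) = 1 / 2 ^ (n + 1) := by
      unfold sawtooth
      have h : (1 : ℝ) / 2 ^ (n + 1) ≤ 1 := by
        rw [div_le_one (by positivity)]
        exact one_le_pow₀ (by norm_num)
      have e : 2 * ((1 : ℝ) / 2 ^ (n + 1 + 1)) = 1 / 2 ^ (n + 1) := by
        rw [pow_succ _ (n + 1)]; field_simp
      have h' : (1 : ℝ) / 2 ^ (n + 1) ≤ 1 / 2 := by
        apply one_div_le_one_div_of_le (by norm_num)
        rw [pow_succ]
        nlinarith [one_le_pow₀ (M₀ := ℝ) (a := 2) (n := n) (by norm_num)]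
      rw [e, min_eq_left (by linarith)]
    rw [this, ih]

theorem abs_err (m : ℕ) (x : ℝ) (hx : x ∈ Set.Icc (0 : ℝ) 1) :
    |x ^ 2 - fApprox m x| = (sawtooth^[m] x - (sawtooth^[m] x) ^ 2) / 2 ^ (2 * m) := by
  obtain ⟨h0, h1⟩ := saw_mem m x hx
  rw [abs_sub_comm, fApprox_sub, abs_of_nonneg]
  apply div_nonneg _ (by positivity)
  nlinarith

/-- sup_{x ∈ [0,1]} |x² − f_m(x)| = 2^{−2(m+1)}. -/
theorem stmt_5 (m : ℕ) :
    sSup ((fun x : ℝ => |x ^ 2 - fApprox m x|) '' Set.Icc (0 : ℝ) 1) =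
      1 / 2 ^ (2 * (m + 1)) := by
  have hv : (1 : ℝ) / 2 ^ (2 * (m + 1)) = (1 / 4) / 2 ^ (2 * m) := by
    rw [mul_add, pow_add]; field_simp; norm_num
  apply IsGreatest.csSup_eq
  constructor
  · have hx : (1 : ℝ) / 2 ^ (m + 1) ∈ Set.Icc (0 : ℝ) 1 := by
      refine ⟨by positivity, ?_⟩
      rw [div_le_one (by positivity)]
      exact one_le_pow₀ (by norm_num)
    refine ⟨1 / 2 ^ (m + 1), hx, ?_⟩
    simp only []
    rw [abs_err m _ hx, saw_half, hv]
    norm_num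
  · rintro _ ⟨x, hx, rfl⟩
    simp only []
    rw [abs_err m x hx, hv]
    gcongr
    nlinarith [sq_nonneg (sawtooth^[m] x - 1 / 2)]
end

section
/- For every M > 0 and every m ∈ ℕ, sup_{x,y ∈ [−M,M]} | xy − M²·( f_m(|x+y|/(2M)) − f_m(|x−y|/(2M)) ) | ≤ M² · 2^{−2(m+1)+1}. -/
theorem saw_step (t : ℝ) :
    t - t ^ 2 - sawtooth t / 4 = (sawtooth t - (sawtooth t) ^ 2) / 4 := by
  unfold sawtooth
  rcases min_choice (2 * t) (2 - 2 * t) with h | h <;> rw [h] <;> ring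

theorem saw_mem_s6 {t : ℝ} (h : 0 ≤ t ∧ t ≤ 1) : 0 ≤ sawtooth t ∧ sawtooth t ≤ 1 := by
  unfold sawtooth
  refine ⟨le_min (by linarith) (by linarith), ?_⟩
  rcases le_total t (1 / 2) with h' | h'
  · exact (min_le_left _ _).trans (by linarith)
  · exact (min_le_right _ _).trans (by linarith)

theorem saw_iter_mem {t : ℝ} (h : 0 ≤ t ∧ t ≤ 1) (m : ℕ) :
    0 ≤ sawtooth^[m] t ∧ sawtooth^[m] t ≤ 1 := by
  induction m with
  | zero => simpa using h
  | succ k ih => rw [Function.iterate_succ_apply']; exact saw_mem_s6 ih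

theorem fApprox_err (m : ℕ) (t : ℝ) :
    fApprox m t - t ^ 2 = (sawtooth^[m] t - (sawtooth^[m] t) ^ 2) / 2 ^ (2 * m) := by
  induction m with
  | zero => simp [fApprox]
  | succ k ih =>
    have h1 : fApprox (k + 1) t = fApprox k t - sawtooth^[k + 1] t / 2 ^ (2 * (k + 1)) := by
      unfold fApprox
      rw [Finset.sum_Icc_succ_top (by omega)]
      ring
    have h2 := saw_step (sawtooth^[k] t)
    have h3 : (2 : ℝ) ^ (2 * (k + 1)) = 2 ^ (2 * k) * 4 := by ring
    rw [h1, h3, Function.iterate_succ_apply', sub_right_comm, ih]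
    have hp : (2 : ℝ) ^ (2 * k) ≠ 0 := by positivity
    field_simp
    linarith

theorem fApprox_bound (m : ℕ) {t : ℝ} (h : 0 ≤ t ∧ t ≤ 1) :
    0 ≤ fApprox m t - t ^ 2 ∧ fApprox m t - t ^ 2 ≤ 1 / 2 ^ (2 * (m + 1)) := by
  obtain ⟨h0, h1⟩ := saw_iter_mem h m
  rw [fApprox_err]
  have h3 : (1 : ℝ) / 2 ^ (2 * (m + 1)) = (1 / 4) / 2 ^ (2 * m) := by
    rw [show (2 : ℝ) ^ (2 * (m + 1)) = 4 * 2 ^ (2 * m) by ring, div_div]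
  rw [h3]
  constructor
  · apply div_nonneg _ (by positivity)
    nlinarith
  · apply div_le_div_of_nonneg_right _ (by positivity)
    nlinarith [sq_nonneg (sawtooth^[m] t - 1 / 2)]

/-- for every M > 0 and m ∈ ℕ,
sup_{x,y ∈ [−M,M]} |xy − M²(f_m(|x+y|/(2M)) − f_m(|x−y|/(2M)))| ≤ M²·2^{−2(m+1)+1}. -/
theorem stmt_6 (M : ℝ) (hM : 0 < M) (m : ℕ) (x y : ℝ)
    (hx : x ∈ Set.Icc (-M) M) (hy : y ∈ Set.Icc (-M) M) :
    |x * y - M ^ 2 * (fApprox m (|x + y| / (2 * M)) - fApprox m (|x - y| / (2 * M)))| ≤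
      M ^ 2 * (2 / 2 ^ (2 * (m + 1))) := by
  obtain ⟨hx1, hx2⟩ := hx
  obtain ⟨hy1, hy2⟩ := hy
  have hu : 0 ≤ |x + y| / (2 * M) ∧ |x + y| / (2 * M) ≤ 1 := by
    refine ⟨by positivity, ?_⟩
    rw [div_le_one (by positivity), abs_le]
    constructor <;> linarith
  have hv : 0 ≤ |x - y| / (2 * M) ∧ |x - y| / (2 * M) ≤ 1 := by
    refine ⟨by positivity, ?_⟩
    rw [div_le_one (by positivity), abs_le]
    constructor <;> linarith
  have key : x * y = M ^ 2 * ((|x + y| / (2 * M)) ^ 2 - (|x - y| / (2 * M)) ^ 2) := by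
    rw [div_pow, div_pow, sq_abs, sq_abs]
    field_simp
    ring
  obtain ⟨a1, a2⟩ := fApprox_bound m hu
  obtain ⟨b1, b2⟩ := fApprox_bound m hv
  rw [key, ← mul_sub, abs_mul, abs_of_nonneg (sq_nonneg M)]
  apply mul_le_mul_of_nonneg_left _ (sq_nonneg M)
  have h2 : (2 : ℝ) / 2 ^ (2 * (m + 1)) = 1 / 2 ^ (2 * (m + 1)) + 1 / 2 ^ (2 * (m + 1)) := by ring
  rw [h2, abs_le]
  constructor <;> linarith
end

section
/- Let ϱ : ℝ → ℝ be a function such that (a) there exists an open set U ⊂ ℝ with ℝ∖U of Lebesgue measure zero and ϱ|_U continuous, and (b) ϱ is bounded on every bounded interval. If for every φ ∈ C_c^∞(ℝ) the convolution ϱ * φ is a polynomial, then there exists a polynomial p such that ϱ = p Lebesgue-almost everywhere. -/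
open MeasureTheory

/-- The `n`-th forward difference at zero, as an explicit sum. -/
noncomputable def Lam (n : ℕ) (f : ℝ → ℝ) : ℝ :=
  ∑ k ∈ Finset.range (n + 1), (((-1 : ℤ) ^ (n - k) * n.choose k : ℤ) : ℝ) * f k

lemma Lam_eq (n : ℕ) (f : ℝ → ℝ) : Lam n f = (fwdDiff (1 : ℝ))^[n] f 0 := by
  rw [fwdDiff_iter_eq_sum_shift]
  unfold Lam
  refine Finset.sum_congr rfl fun k _ => ?_
  rw [zsmul_eq_mul]
  simp

lemma Lam_lt (n : ℕ) (p : Polynomial ℝ) (h : p.natDegree < n) : Lam n (fun x => p.eval x) = 0 := by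
  rw [Lam_eq]
  have := Polynomial.fwdDiff_iter_eq_zero_of_degree_lt h
  exact congrFun this 0

lemma Lam_deg (p : Polynomial ℝ) (h : p ≠ 0) : Lam p.natDegree (fun x => p.eval x) ≠ 0 := by
  rw [Lam_eq]
  have := congrFun (Polynomial.fwdDiff_iter_degree_eq_factorial p) 0
  change (fwdDiff (1 : ℝ))^[p.natDegree] p.eval 0 ≠ 0
  rw [this]
  simp [h, Nat.factorial_ne_zero]

lemma Lam_mul (n : ℕ) (c : ℝ) (f : ℝ → ℝ) : Lam n (fun x => c * f x) = c * Lam n f := by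
  unfold Lam
  rw [Finset.mul_sum]
  refine Finset.sum_congr rfl fun k _ => by ring

lemma Lam_hasSum (n : ℕ) (f : ℕ → ℝ → ℝ) (g : ℝ → ℝ) (h : ∀ x, HasSum (fun m => f m x) (g x)) :
    HasSum (fun m => Lam n (f m)) (Lam n g) := by
  unfold Lam
  exact hasSum_sum fun k _ => (h k).mul_left _

/-- A fast decaying sequence. -/
lemma exists_decay (B : ℕ → ℝ) (hB : ∀ m, 0 ≤ B m) :
    ∃ c : ℕ → ℝ, (∀ m, 0 < c m) ∧ (∀ m, c m * B m ≤ (1 / 4) ^ m) ∧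
      ∀ n k, c (n + 1 + k) * B (n + 1 + k) ≤ c n * (1 / 4) ^ (k + 1) := by
  set c : ℕ → ℝ := fun m => ∏ i ∈ Finset.range (m + 1), (1 / (4 * (1 + B i))) with hc
  have hsucc : ∀ m, c (m + 1) = c m * (1 / (4 * (1 + B (m + 1)))) := fun m =>
    Finset.prod_range_succ _ _
  have hpos : ∀ m, 0 < c m := fun m => Finset.prod_pos fun i _ => by
    have := hB i
    positivity
  have hle : ∀ m, c (m + 1) ≤ c m * (1 / 4) := fun m => by
    rw [hsucc]
    have h1 := hB (m + 1)
    refine mul_le_mul_of_nonneg_left ?_ (hpos m).le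
    exact one_div_le_one_div_of_le (by norm_num) (by linarith)
  have hleB : ∀ m, c (m + 1) * B (m + 1) ≤ c m * (1 / 4) := fun m => by
    rw [hsucc, mul_assoc]
    have h1 := hB (m + 1)
    refine mul_le_mul_of_nonneg_left ?_ (hpos m).le
    rw [div_mul_eq_mul_div, div_le_div_iff₀ (by positivity) (by norm_num)]
    linarith
  have hit : ∀ n k, c (n + k) ≤ c n * (1 / 4) ^ k := by
    intro n k
    induction k with
    | zero => simp
    | succ k ih =>
      have := hle (n + k)
      rw [← add_assoc, pow_succ]
      linarith
  have h0 : c 0 = 1 / (4 * (1 + B 0)) := by simp [hc]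
  have h0' : c 0 ≤ 1 := by
    rw [h0, div_le_one (by have := hB 0; positivity)]
    have := hB 0
    linarith
  refine ⟨c, hpos, ?_, ?_⟩
  · intro m
    cases m with
    | zero =>
      rw [h0]
      have := hB 0
      rw [div_mul_eq_mul_div, pow_zero, div_le_one (by positivity)]
      linarith
    | succ m =>
      have h1 := hleB m
      have h2 := hit 0 m
      rw [zero_add] at h2
      have h3 : c 0 * (1 / 4 : ℝ) ^ m ≤ (1 / 4) ^ m :=
        mul_le_of_le_one_left (by positivity) h0'
      rw [pow_succ]
      linarith
  · intro n k
    have h1 := hleB (n + k)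
    have h2 := hit n k
    have e : n + 1 + k = n + k + 1 := by ring
    rw [e, pow_succ]
    linarith

lemma not_hasSum_zero (f : ℕ → ℝ) (n : ℕ) (c : ℝ) (hc : 0 < c) (h0 : ∀ m < n, f m = 0)
    (hn : f n = c) (hgt : ∀ k, |f (n + 1 + k)| ≤ c * (1 / 4) ^ (k + 1)) : ¬ HasSum f 0 := by
  intro h
  have h1 : HasSum (fun k => f (k + (n + 1))) (0 - ∑ i ∈ Finset.range (n + 1), f i) :=
    (hasSum_nat_add_iff' (n + 1)).2 h
  rw [Finset.sum_range_succ, Finset.sum_eq_zero (fun i hi => h0 i (Finset.mem_range.1 hi)), hn] at h1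
  have h2 : HasSum (fun k : ℕ => c * (1 / 4 : ℝ) ^ (k + 1)) (c * (1 / 4) * (1 - 1 / 4)⁻¹) := by
    have := (hasSum_geometric_of_lt_one (r := (1 / 4 : ℝ)) (by norm_num) (by norm_num)).mul_left
      (c * (1 / 4))
    have e : (fun k : ℕ => c * (1 / 4 : ℝ) ^ (k + 1)) = fun k => c * (1 / 4) * (1 / 4) ^ k := by
      ext k
      ring
    rw [e]
    exact this
  have h3 : |(0 - (0 + c))| ≤ c * (1 / 4) * (1 - 1 / 4)⁻¹ := by
    rw [← h1.tsum_eq, ← h2.tsum_eq, ← Real.norm_eq_abs]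
    refine tsum_of_norm_bounded h2.summable.hasSum fun k => ?_
    rw [add_comm k]
    exact hgt k
  rw [zero_add, zero_sub, abs_neg, abs_of_pos hc] at h3
  norm_num at h3
  linarith

lemma aesm (ϱ : ℝ → ℝ)
    (ha : ∃ U : Set ℝ, IsOpen U ∧ volume Uᶜ = 0 ∧ ContinuousOn ϱ U) :
    AEStronglyMeasurable ϱ volume := by
  obtain ⟨U, hU, h0, hc⟩ := ha
  have h1 := hc.aestronglyMeasurable (μ := volume) hU.measurableSet
  rwa [Measure.restrict_eq_self_of_ae_mem] at h1
  exact h0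

lemma locint (ϱ : ℝ → ℝ) (hm : AEStronglyMeasurable ϱ volume)
    (hb : ∀ a b : ℝ, ∃ M : ℝ, ∀ x ∈ Set.Icc a b, |ϱ x| ≤ M) : LocallyIntegrable ϱ volume := by
  intro x
  obtain ⟨M, hM⟩ := hb (x - 1) (x + 1)
  refine ⟨Set.Icc (x - 1) (x + 1), Icc_mem_nhds (by linarith) (by linarith), ?_⟩
  refine Measure.integrableOn_of_bounded (M := M) (by simp) hm ?_
  exact (ae_restrict_iff' measurableSet_Icc).2 (Filter.Eventually.of_forall hM)

/-- Integral domination for a function supported in `[-1,1]`. -/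
lemma int_dom (ϱ : ℝ → ℝ) (hm : AEStronglyMeasurable ϱ volume) (x M : ℝ)
    (hM : ∀ y ∈ Set.Icc (x - 1) (x + 1), |ϱ y| ≤ M) (ψ : ℝ → ℝ) (hψ : Continuous ψ)
    (hs : ∀ y ∉ Set.Icc (-1 : ℝ) 1, ψ y = 0) (C : ℝ) (hC : ∀ y, |ψ y| ≤ C) :
    Integrable (fun y => ϱ (x - y) * ψ y) volume ∧ ∫ y, ‖ϱ (x - y) * ψ y‖ ≤ 2 * M * C := by
  have hM0 : 0 ≤ M := (abs_nonneg _).trans (hM x ⟨by linarith, by linarith⟩)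
  have hg : Integrable ((Set.Icc (-1 : ℝ) 1).indicator (fun _ => M * C)) volume :=
    (integrable_indicator_iff measurableSet_Icc).2 (integrableOn_const (by simp))
  have hbd : ∀ y, ‖ϱ (x - y) * ψ y‖ ≤ (Set.Icc (-1 : ℝ) 1).indicator (fun _ => M * C) y := by
    intro y
    by_cases hy : y ∈ Set.Icc (-1 : ℝ) 1
    · rw [Set.indicator_of_mem hy, norm_mul]
      refine mul_le_mul (hM _ ⟨by linarith [hy.2], by linarith [hy.1]⟩) (hC y) (norm_nonneg _) hM0
    · rw [Set.indicator_of_notMem hy, hs y hy]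
      simp
  have hmeas : AEStronglyMeasurable (fun y => ϱ (x - y) * ψ y) volume :=
    (hm.comp_quasiMeasurePreserving
      (Measure.measurePreserving_sub_left volume x).quasiMeasurePreserving).mul
      hψ.aestronglyMeasurable
  refine ⟨hg.mono' hmeas (Filter.Eventually.of_forall hbd), ?_⟩
  calc ∫ y, ‖ϱ (x - y) * ψ y‖ ≤ ∫ y, (Set.Icc (-1 : ℝ) 1).indicator (fun _ => M * C) y :=
        integral_mono_of_nonneg (Filter.Eventually.of_forall fun _ => norm_nonneg _) hg
          (Filter.Eventually.of_forall hbd)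
    _ = 2 * M * C := by
        rw [integral_indicator measurableSet_Icc, setIntegral_const]
        simp [Measure.real]
        norm_num
        ring

lemma deg_bound (ϱ : ℝ → ℝ) (hm : AEStronglyMeasurable ϱ volume)
    (hb : ∀ a b : ℝ, ∃ M : ℝ, ∀ x ∈ Set.Icc a b, |ϱ x| ≤ M)
    (hconv : ∀ φ : ℝ → ℝ, ContDiff ℝ (⊤ : ℕ∞) φ → HasCompactSupport φ →
      ∃ p : Polynomial ℝ, ∀ x : ℝ, (∫ y, ϱ (x - y) * φ y) = p.eval x) :
    ∃ N : ℕ, ∀ φ : ℝ → ℝ, ContDiff ℝ (⊤ : ℕ∞) φ → (∀ y ∉ Set.Icc (-1 : ℝ) 1, φ y = 0) →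
      ∃ p : Polynomial ℝ, p.natDegree ≤ N ∧ ∀ x : ℝ, (∫ y, ϱ (x - y) * φ y) = p.eval x := by
  by_contra! hcon
  obtain ⟨d, hd, hP⟩ := Nat.exists_strictMono_subsequence
    (P := fun d => ∃ (φ : ℝ → ℝ) (p : Polynomial ℝ), ContDiff ℝ (⊤ : ℕ∞) φ ∧
      (∀ y ∉ Set.Icc (-1 : ℝ) 1, φ y = 0) ∧ (∀ x : ℝ, (∫ y, ϱ (x - y) * φ y) = p.eval x) ∧
      p.natDegree = d ∧ Lam d (fun x => p.eval x) = 1) (by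
    intro N
    obtain ⟨φ, h1, h2, h3⟩ := hcon N
    obtain ⟨p, hp⟩ := hconv φ h1 (HasCompactSupport.intro isCompact_Icc h2)
    have hdeg : N < p.natDegree := by
      by_contra! hle
      obtain ⟨x, hx⟩ := h3 p hle
      exact hx (hp x)
    have hp0 : p ≠ 0 := by
      rintro rfl
      simp at hdeg
    have hL := Lam_deg p hp0
    set L := Lam p.natDegree (fun x => p.eval x) with hLdef
    refine ⟨p.natDegree, hdeg, fun y => L⁻¹ * φ y, Polynomial.C L⁻¹ * p, contDiff_const.mul h1,
      fun y hy => by simp [h2 y hy], ?_, ?_, ?_⟩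
    · intro x
      rw [Polynomial.eval_mul, Polynomial.eval_C, ← hp, ← integral_const_mul]
      congr 1
      ext y
      ring
    · exact Polynomial.natDegree_C_mul (inv_ne_zero hL)
    · simp only [Polynomial.eval_mul, Polynomial.eval_C]
      rw [Lam_mul, ← hLdef, inv_mul_cancel₀ hL])
  choose φ p hφ hs hp hpd hpL using hP
  have hcs : ∀ m, HasCompactSupport (φ m) := fun m => HasCompactSupport.intro isCompact_Icc (hs m)
  have hbdd : ∀ m k : ℕ, ∃ C, ∀ x, ‖iteratedFDeriv ℝ k (φ m) x‖ ≤ C := fun m k =>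
    ((hφ m).continuous_iteratedFDeriv (by exact_mod_cast le_top)).bounded_above_of_compact_support
      ((hcs m).iteratedFDeriv k)
  choose C hC using hbdd
  have hC0 : ∀ m k, 0 ≤ C m k := fun m k => (norm_nonneg _).trans (hC m k 0)
  set B : ℕ → ℝ := fun m => (∑ k ∈ Finset.range (m + 1), C m k) +
    ∑ n ∈ Finset.range m, |Lam (d n) (fun x => (p m).eval x)| with hB
  have hB0 : ∀ m, 0 ≤ B m := fun m =>
    add_nonneg (Finset.sum_nonneg fun k _ => hC0 m k) (Finset.sum_nonneg fun k _ => abs_nonneg _)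
  have hCB : ∀ m k, k ≤ m → C m k ≤ B m := fun m k hk => by
    have h1 := Finset.single_le_sum (f := fun k => C m k) (fun k _ => hC0 m k)
      (Finset.mem_range.2 (Nat.lt_succ_of_le hk))
    have h2 : 0 ≤ ∑ n ∈ Finset.range m, |Lam (d n) (fun x => (p m).eval x)| :=
      Finset.sum_nonneg fun k _ => abs_nonneg _
    simp only [hB]
    simp only [Nat.succ_eq_add_one] at h1
    linarith
  have hLB : ∀ m n, n < m → |Lam (d n) (fun x => (p m).eval x)| ≤ B m := fun m n hn => by
    have h1 := Finset.single_le_sum (f := fun n => |Lam (d n) (fun x => (p m).eval x)|)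
      (fun k _ => abs_nonneg _) (Finset.mem_range.2 hn)
    have h2 : 0 ≤ ∑ k ∈ Finset.range (m + 1), C m k := Finset.sum_nonneg fun k _ => hC0 m k
    simp only [hB]
    linarith
  obtain ⟨c, hc, hc1, hc2⟩ := exists_decay B hB0
  have hgeo : Summable (fun m : ℕ => (1 / 4 : ℝ) ^ m) :=
    summable_geometric_of_lt_one (by norm_num) (by norm_num)
  have hΦ : ContDiff ℝ (⊤ : ℕ∞) (fun y => ∑' m, c m * φ m y) := by
    refine contDiff_tsum_of_eventually (v := fun _ m => (1 / 4 : ℝ) ^ m)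
      (fun m => contDiff_const.mul (hφ m)) (fun _ _ => hgeo) ?_
    intro k _
    rw [Nat.cofinite_eq_atTop]
    filter_upwards [Filter.eventually_ge_atTop k] with m hkm x
    have e : (fun y => c m * φ m y) = c m • φ m := rfl
    rw [e, iteratedFDeriv_const_smul_apply
      ((hφ m).contDiffAt.of_le (by exact_mod_cast le_top)), norm_smul, Real.norm_of_nonneg (hc m).le]
    exact (mul_le_mul_of_nonneg_left ((hC m k x).trans (hCB m k hkm)) (hc m).le).trans (hc1 m)
  have hΦs : ∀ y ∉ Set.Icc (-1 : ℝ) 1, (∑' m, c m * φ m y) = 0 := fun y hy => by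
    simp [hs _ y hy]
  obtain ⟨q, hq⟩ := hconv _ hΦ (HasCompactSupport.intro isCompact_Icc hΦs)
  have hbd0 : ∀ m y, |c m * φ m y| ≤ (1 / 4) ^ m := fun m y => by
    have h1 := hC m 0 y
    rw [norm_iteratedFDeriv_zero, Real.norm_eq_abs] at h1
    rw [abs_mul, abs_of_pos (hc m)]
    exact (mul_le_mul_of_nonneg_left (h1.trans (hCB m 0 (Nat.zero_le _))) (hc m).le).trans (hc1 m)
  have hsum : ∀ x, HasSum (fun m => c m * (p m).eval x) (q.eval x) := by
    intro x
    obtain ⟨M, hM⟩ := hb (x - 1) (x + 1)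
    have hdom := fun m => int_dom ϱ hm x M hM (fun y => c m * φ m y)
      (continuous_const.mul (hφ m).continuous) (fun y hy => by simp [hs m y hy]) _ (hbd0 m)
    have := hasSum_integral_of_summable_integral_norm (fun m => (hdom m).1)
      (Summable.of_nonneg_of_le (fun m => integral_nonneg fun _ => norm_nonneg _)
        (fun m => (hdom m).2) (hgeo.mul_left (2 * M)))
    rw [← hq]
    simp only [tsum_mul_left] at this
    have e : (fun m => c m * (p m).eval x) = fun m => ∫ y, ϱ (x - y) * (c m * φ m y) := by
      ext m
      rw [← hp, ← integral_const_mul]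
      congr 1
      ext y
      ring
    rw [e]
    exact this
  set n := q.natDegree + 1 with hn
  have hfin := Lam_hasSum (d n) _ _ hsum
  rw [Lam_lt (d n) q (lt_of_lt_of_le (Nat.lt_succ_self _) (hd.id_le n))] at hfin
  simp only [Lam_mul] at hfin
  refine not_hasSum_zero _ n (c n) (hc n) ?_ ?_ ?_ hfin
  · intro m hmn
    rw [Lam_lt _ _ (by rw [hpd]; exact hd hmn), mul_zero]
  · rw [hpL, mul_one]
  · intro k
    rw [abs_mul, abs_of_pos (hc _)]
    exact (mul_le_mul_of_nonneg_left (hLB (n + 1 + k) n (by omega)) (hc _).le).trans (hc2 n k)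

/-- if ϱ is continuous off a closed Lebesgue-null set, bounded on
bounded intervals, and ϱ * φ is a polynomial for every φ ∈ C_c^∞(ℝ), then ϱ is
almost everywhere equal to a polynomial. -/
theorem stmt_13 (ϱ : ℝ → ℝ)
    (ha : ∃ U : Set ℝ, IsOpen U ∧ volume Uᶜ = 0 ∧ ContinuousOn ϱ U)
    (hb : ∀ a b : ℝ, ∃ M : ℝ, ∀ x ∈ Set.Icc a b, |ϱ x| ≤ M)
    (hconv : ∀ φ : ℝ → ℝ, ContDiff ℝ (⊤ : ℕ∞) φ → HasCompactSupport φ →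
      ∃ p : Polynomial ℝ, ∀ x : ℝ, (∫ y, ϱ (x - y) * φ y) = p.eval x) :
    ∃ p : Polynomial ℝ, ϱ =ᵐ[volume] fun x => p.eval x := by
  have hm := aesm ϱ ha
  obtain ⟨N, hN⟩ := deg_bound ϱ hm hb hconv
  let β : ℕ → ContDiffBump (0 : ℝ) := fun j =>
    { rIn := 1 / (j + 1 : ℝ) / 2
      rOut := 1 / (j + 1 : ℝ)
      rIn_pos := by positivity
      rIn_lt_rOut := half_lt_self (by positivity) }
  have hβ : Filter.Tendsto (fun j => (β j).rOut) Filter.atTop (nhds 0) :=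
    tendsto_one_div_add_atTop_nhds_zero_nat
  have hlim := ContDiffBump.ae_convolution_tendsto_right_of_locallyIntegrable (K := 2) hβ
    (Filter.Eventually.of_forall fun j => by
      change 1 / (j + 1 : ℝ) ≤ 2 * (1 / (j + 1 : ℝ) / 2)
      linarith) (locint ϱ hm hb)
  have hpoly : ∀ j, ∃ p : Polynomial ℝ, p.natDegree ≤ N ∧
      ∀ x, convolution ((β j).normed volume) ϱ (ContinuousLinearMap.lsmul ℝ ℝ) volume x
        = p.eval x := by
    intro j
    obtain ⟨p, hp, hpe⟩ := hN ((β j).normed volume) (ContDiffBump.contDiff_normed _) (by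
      intro y hy
      have hsup := (β j).support_normed_eq (μ := volume)
      by_contra hne
      have : y ∈ Function.support ((β j).normed volume) := hne
      rw [hsup, Metric.mem_ball, Real.dist_eq, sub_zero] at this
      have hle : (β j).rOut ≤ 1 := by
        change 1 / (j + 1 : ℝ) ≤ 1
        rw [div_le_one (by positivity)]
        linarith [(Nat.cast_nonneg j : (0 : ℝ) ≤ j)]
      have h2 := abs_lt.1 (this.trans_le hle)
      exact hy ⟨h2.1.le, h2.2.le⟩)
    refine ⟨p, hp, fun x => ?_⟩
    rw [← hpe, convolution_lsmul]
    congr 1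
    ext y
    rw [smul_eq_mul, mul_comm]
  choose p hpN hpe using hpoly
  simp only [hpe] at hlim
  have hinf : {x | Filter.Tendsto (fun j => (p j).eval x) Filter.atTop (nhds (ϱ x))}.Infinite := by
    intro hfin
    have h1 := hfin.measure_zero (volume : Measure ℝ)
    have h2 : volume ({x | Filter.Tendsto (fun j => (p j).eval x) Filter.atTop (nhds (ϱ x))}ᶜ) = 0 :=
      hlim
    have h3 := measure_union_null h1 h2
    rw [Set.union_compl_self] at h3
    simp at h3
  obtain ⟨s, hsS, hscard⟩ := hinf.exists_subset_card_eq (N + 1)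
  refine ⟨Lagrange.interpolate s id ϱ, ?_⟩
  filter_upwards [hlim] with x hx
  refine tendsto_nhds_unique hx ?_
  have e : ∀ j, (p j).eval x = ∑ i ∈ s, (p j).eval i * (Lagrange.basis s id i).eval x := by
    intro j
    have hdeg : (p j).degree < s.card := by
      rw [hscard]
      exact lt_of_le_of_lt (Polynomial.degree_le_of_natDegree_le (hpN j))
        (by exact_mod_cast Nat.lt_succ_self N)
    have := Lagrange.eq_interpolate (v := id) (Set.injOn_id _) hdeg
    conv_lhs => rw [this]
    simp [Lagrange.interpolate_apply, Polynomial.eval_finsetSum]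
  simp only [e]
  rw [Lagrange.interpolate_apply, Polynomial.eval_finsetSum]
  simp only [Polynomial.eval_mul, Polynomial.eval_C]
  exact tendsto_finsetSum _ fun i hi => (hsS hi).mul_const _
end

section
/- Let ϱ : ℝ → ℝ be a function such that (a) there exists an open set U ⊂ ℝ with ℝ∖U of Lebesgue measure zero and ϱ|_U continuous, (b) ϱ is bounded on every bounded interval, and (c) there is no polynomial p with ϱ = p Lebesgue-almost everywhere. Let Ω ⊂ ℝ^d be a bounded measurable set and p ∈ (0, ∞). Then the linear span of { x ↦ ϱ(⟨a, x⟩ + b) restricted to Ω : a ∈ ℝ^d, b ∈ ℝ } is dense in L^p(Ω): for every f ∈ L^p(Ω) and every ε > 0 there is an element g of this span with ∫_Ω |f − g|^p < ε^p. -/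
open MeasureTheory

namespace NNDense

open Filter Topology Set

/-- `h` lies in the `L^p(μ)`-closure of the submodule `S`. -/
def Appr {E : Type*} [MeasurableSpace E] (μ : Measure E) (p : ENNReal)
    (S : Submodule ℝ (E → ℝ)) (h : E → ℝ) : Prop :=
  AEStronglyMeasurable h μ ∧ ∀ ε : ENNReal, ε ≠ 0 → ∃ g ∈ S, AEStronglyMeasurable g μ ∧
    eLpNorm (h - g) p μ < ε

section
variable {E : Type*} [MeasurableSpace E] {μ : Measure E} {p : ENNReal}
  {S : Submodule ℝ (E → ℝ)}

lemma Appr.of_mem {h : E → ℝ} (hh : h ∈ S) (hm : AEStronglyMeasurable h μ) : Appr μ p S h :=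
  ⟨hm, fun ε hε => ⟨h, hh, hm, by simpa using pos_iff_ne_zero.2 hε⟩⟩

lemma Appr.of_near {h : E → ℝ} (hm : AEStronglyMeasurable h μ)
    (H : ∀ ε : ENNReal, ε ≠ 0 → ∃ g, Appr μ p S g ∧ eLpNorm (h - g) p μ ≤ ε) :
    Appr μ p S h := by
  refine ⟨hm, fun ε hε => ?_⟩
  obtain ⟨η, hη, hη'⟩ := exists_Lp_half ℝ μ p hε
  obtain ⟨g, hg, hgn⟩ := H η hη.ne'
  obtain ⟨k, hk, hkm, hkn⟩ := hg.2 η hη.ne'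
  refine ⟨k, hk, hkm, ?_⟩
  have := hη' (h - g) (g - k) (hm.sub hg.1) (hg.1.sub hkm) hgn hkn.le
  simpa using this

lemma Appr.add {h k : E → ℝ} (hh : Appr μ p S h) (hk : Appr μ p S k) :
    Appr μ p S (h + k) := by
  refine ⟨hh.1.add hk.1, fun ε hε => ?_⟩
  obtain ⟨η, hη, hη'⟩ := exists_Lp_half ℝ μ p hε
  obtain ⟨g, hg, hgm, hgn⟩ := hh.2 η hη.ne'
  obtain ⟨l, hl, hlm, hln⟩ := hk.2 η hη.ne'
  refine ⟨g + l, S.add_mem hg hl, hgm.add hlm, ?_⟩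
  have := hη' (h - g) (k - l) (hh.1.sub hgm) (hk.1.sub hlm) hgn.le hln.le
  rwa [show h + k - (g + l) = (h - g) + (k - l) by abel]

lemma Appr.smul {h : E → ℝ} (c : ℝ) (hh : Appr μ p S h) : Appr μ p S (c • h) := by
  refine ⟨hh.1.const_smul c, fun ε hε => ?_⟩
  have hpos : ε / (‖c‖ₑ + 1) ≠ 0 := by
    simp [ENNReal.div_eq_zero_iff, hε]
  obtain ⟨g, hg, hgm, hgn⟩ := hh.2 _ hpos
  refine ⟨c • g, S.smul_mem c hg, hgm.const_smul c, ?_⟩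
  rw [← smul_sub, eLpNorm_const_smul]
  have h1 : ‖c‖ₑ + 1 ≠ 0 := by simp
  have h2 : ‖c‖ₑ + 1 ≠ ⊤ := by simp
  have := (ENNReal.lt_div_iff_mul_lt (Or.inl h1) (Or.inl h2)).1 hgn
  calc _ ≤ eLpNorm (h - g) p μ * (‖c‖ₑ + 1) := by
        rw [mul_comm]; gcongr; exact le_self_add
    _ < ε := this

lemma Appr.zero : Appr μ p S 0 := Appr.of_mem S.zero_mem aestronglyMeasurable_zero

lemma Appr.sub {h k : E → ℝ} (hh : Appr μ p S h) (hk : Appr μ p S k) :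
    Appr μ p S (h - k) := by
  have := hh.add (hk.smul (-1))
  simpa [sub_eq_add_neg] using this

lemma Appr.sum {ι : Type*} (s : Finset ι) {h : ι → E → ℝ} (hh : ∀ i ∈ s, Appr μ p S (h i)) :
    Appr μ p S (∑ i ∈ s, h i) :=
  Finset.sum_induction _ (Appr μ p S) (fun _ _ => Appr.add) Appr.zero hh

lemma Appr.lim [IsFiniteMeasure μ] (hp0 : p ≠ 0) (hpt : p ≠ ⊤) {h : ℕ → E → ℝ} {k : E → ℝ}
    (C : ℝ) (hh : ∀ n, Appr μ p S (h n)) (hb : ∀ n, ∀ᵐ x ∂μ, |h n x| ≤ C)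
    (hl : ∀ᵐ x ∂μ, Tendsto (fun n => h n x) atTop (𝓝 (k x))) : Appr μ p S k := by
  have hkm : AEStronglyMeasurable k μ :=
    aestronglyMeasurable_of_tendsto_ae atTop (fun n => (hh n).1) hl
  have hpr : 0 < p.toReal := ENNReal.toReal_pos hp0 hpt
  have hkb : ∀ᵐ x ∂μ, |k x| ≤ C := by
    filter_upwards [hl, ae_all_iff.2 hb] with x hx hx'
    exact le_of_tendsto hx.abs (Eventually.of_forall hx')
  have key : Tendsto (fun n => ∫⁻ x, ‖(k - h n) x‖ₑ ^ p.toReal ∂μ) atTop (𝓝 (∫⁻ x, 0 ∂μ)) := by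
    refine tendsto_lintegral_of_dominated_convergence'
      (fun _ => ENNReal.ofReal (C + C) ^ p.toReal) (fun n => ?_) (fun n => ?_) ?_ ?_
    · exact ((hkm.sub (hh n).1).enorm).pow_const _
    · filter_upwards [hkb, hb n] with x h1 h2
      gcongr
      rw [Real.enorm_eq_ofReal_abs]
      apply ENNReal.ofReal_le_ofReal
      exact (abs_sub _ _).trans (add_le_add h1 h2)
    · rw [lintegral_const]
      exact ENNReal.mul_ne_top (by simp [hpr.le]) (measure_ne_top _ _)
    · filter_upwards [hl] with x hx
      have h1 : Tendsto (fun n => ‖(k - h n) x‖ₑ) atTop (𝓝 0) := by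
        have : Tendsto (fun n => k x - h n x) atTop (𝓝 (k x - k x)) := tendsto_const_nhds.sub hx
        rw [sub_self] at this
        have := this.enorm
        simpa using this
      have := (ENNReal.continuous_rpow_const (y := p.toReal)).tendsto 0 |>.comp h1
      simpa [hpr, Function.comp_def] using this
  refine Appr.of_near hkm fun ε hε => ?_
  have h2 : Tendsto (fun n => eLpNorm (k - h n) p μ) atTop (𝓝 0) := by
    simp only [eLpNorm_eq_lintegral_rpow_enorm_toReal hp0 hpt]
    have := (ENNReal.continuous_rpow_const (y := 1 / p.toReal)).tendsto _ |>.comp key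
    simpa [hpr, Function.comp_def] using this
  obtain ⟨n, hn⟩ := (h2.eventually (gt_mem_nhds (pos_iff_ne_zero.2 hε))).exists
  exact ⟨h n, hh n, hn.le⟩

end

/-- Riemann sums converge for bounded a.e. continuous functions. -/
lemma riemann (F : ℝ → ℝ) (M : ℝ) (hM : ∀ t, |F t| ≤ M) (hF : ∀ᵐ t, ContinuousAt F t) :
    Tendsto (fun n : ℕ => ∑ i ∈ Finset.range (n + 1), (1 / ((n : ℝ) + 1)) * F (i / ((n : ℝ) + 1)))
      atTop (𝓝 (∫ t in (0:ℝ)..1, F t)) := by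
  have hstep : ∀ n : ℕ, ∑ i ∈ Finset.range (n + 1), (1 / ((n : ℝ) + 1)) * F (i / ((n : ℝ) + 1))
      = ∫ t in (0:ℝ)..1, F (⌊((n : ℝ) + 1) * t⌋ / ((n : ℝ) + 1)) := by
    intro n
    have hn : (0 : ℝ) < (n : ℝ) + 1 := by positivity
    set G : ℝ → ℝ := fun t => F (⌊((n : ℝ) + 1) * t⌋ / ((n : ℝ) + 1)) with hG
    have hmeas : Measurable G := by
      have : G = (fun z : ℤ => F (z / ((n : ℝ) + 1))) ∘ fun t : ℝ => ⌊((n : ℝ) + 1) * t⌋ := rfl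
      rw [this]
      exact (measurable_from_top).comp (Int.measurable_floor.comp (measurable_const_mul _))
    have hint : ∀ a b, IntervalIntegrable G volume a b := by
      intro a b
      refine (intervalIntegrable_const (c := M)).mono_fun' hmeas.aestronglyMeasurable ?_
      exact Eventually.of_forall fun t => hM _
    have := intervalIntegral.sum_integral_adjacent_intervals (μ := volume) (f := G)
      (a := fun i : ℕ => (i : ℝ) / ((n : ℝ) + 1)) (n := n + 1) (fun k _ => hint _ _)
    have e1 : ((n + 1 : ℕ) : ℝ) / ((n : ℝ) + 1) = 1 := by push_cast; field_simp
    simp only [e1, Nat.cast_zero, zero_div] at this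
    rw [← this]
    refine Finset.sum_congr rfl fun i _ => ?_
    have hle : (i : ℝ) / ((n : ℝ) + 1) ≤ ((i + 1 : ℕ) : ℝ) / ((n : ℝ) + 1) := by
      gcongr; simp
    have : ∫ t in ((i : ℝ) / ((n : ℝ) + 1))..(((i + 1 : ℕ) : ℝ) / ((n : ℝ) + 1)), G t
        = ∫ t in ((i : ℝ) / ((n : ℝ) + 1))..(((i + 1 : ℕ) : ℝ) / ((n : ℝ) + 1)),
          F (i / ((n : ℝ) + 1)) := by
      rw [intervalIntegral.integral_of_le hle, intervalIntegral.integral_of_le hle,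
        integral_Ioc_eq_integral_Ioo, integral_Ioc_eq_integral_Ioo]
      refine setIntegral_congr_fun measurableSet_Ioo fun t ht => ?_
      have h1 := (div_lt_iff₀ hn).1 ht.1
      have h2 := (lt_div_iff₀ hn).1 ht.2
      have : ⌊((n : ℝ) + 1) * t⌋ = (i : ℤ) := by
        rw [Int.floor_eq_iff]
        push_cast at *
        constructor <;> nlinarith
      simp [hG, this]
    rw [this, intervalIntegral.integral_const]
    simp only [smul_eq_mul]
    congr 1
    push_cast
    field_simp
    ring
  simp only [hstep]
  refine intervalIntegral.tendsto_integral_filter_of_dominated_convergence (fun _ => M) ?_ ?_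
    intervalIntegrable_const ?_
  · refine Eventually.of_forall fun n => Measurable.aestronglyMeasurable ?_
    exact (measurable_from_top (f := fun z : ℤ => F (z / ((n : ℝ) + 1)))).comp
      (Int.measurable_floor.comp (measurable_const_mul _))
  · exact Eventually.of_forall fun n => Eventually.of_forall fun t _ => hM _
  · filter_upwards [hF] with t ht _
    refine ht.tendsto.comp ?_
    have hT : Tendsto (fun n : ℕ => t - 1 / ((n : ℝ) + 1)) atTop (𝓝 t) := by
      simpa using tendsto_const_nhds (x := t).sub (tendsto_one_div_add_atTop_nhds_zero_nat (𝕜 := ℝ))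
    refine tendsto_of_tendsto_of_tendsto_of_le_of_le hT tendsto_const_nhds (fun n => ?_) fun n => ?_
    · have hn : (0 : ℝ) < (n : ℝ) + 1 := by positivity
      have := Int.lt_floor_add_one (((n : ℝ) + 1) * t)
      simp only
      rw [le_div_iff₀ hn, sub_mul, one_div, inv_mul_cancel₀ hn.ne']
      linarith
    · have hn : (0 : ℝ) < (n : ℝ) + 1 := by positivity
      have := Int.floor_le (((n : ℝ) + 1) * t)
      simp only
      rw [div_le_iff₀ hn]
      linarith

/-- A smooth function with vanishing `k`-th derivative is a polynomial of degree `< k`. -/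
lemma poly_of_iteratedDeriv (k : ℕ) : ∀ (g : ℝ → ℝ), ContDiff ℝ (⊤ : ℕ∞) g →
    (∀ b, iteratedDeriv k g b = 0) →
    ∃ P : Polynomial ℝ, P.degree < k ∧ ∀ x, g x = P.eval x := by
  intro g hg h0
  rcases k with _ | n
  · exact ⟨0, by simp, fun x => by simpa using h0 x⟩
  · refine ⟨∑ i ∈ Finset.range (n + 1), Polynomial.monomial i (iteratedDeriv i g 0 / i.factorial),
      ?_, fun x => ?_⟩
    · refine (Polynomial.degree_sum_le _ _).trans_lt ?_
      refine (Finset.sup_lt_iff (by simp [bot_lt_iff_ne_bot])).2 fun i hi => ?_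
      refine (Polynomial.degree_monomial_le _ _).trans_lt ?_
      exact_mod_cast Finset.mem_range.1 hi
    · have hu : ∀ i, ∀ s : Set ℝ, UniqueDiffOn ℝ s → (0:ℝ) ∈ s →
          iteratedDerivWithin i g s 0 = iteratedDeriv i g 0 := fun i s hs h0s =>
        iteratedDerivWithin_eq_iteratedDeriv hs
          ((hg.of_le (by exact_mod_cast le_top)).contDiffAt) h0s
      rw [Polynomial.eval_finsetSum]
      rcases eq_or_ne 0 x with rfl | hx
      · rw [Finset.sum_eq_single 0]
        · simp
        · intro i _ hi
          simp [hi]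
        · simp
      · obtain ⟨x', -, hx'⟩ := taylor_mean_remainder_lagrange_iteratedDeriv (n := n) hx
          ((hg.of_le (by exact_mod_cast le_top)).contDiffOn)
        rw [h0, taylor_within_apply, zero_mul, zero_div, sub_eq_zero] at hx'
        rw [hx']
        refine Finset.sum_congr rfl fun i _ => ?_
        rw [hu i _ (uniqueDiffOn_uIcc hx) left_mem_uIcc]
        simp only [Polynomial.eval_monomial, smul_eq_mul, sub_zero]
        ring

lemma ae_poly (ϱ : ℝ → ℝ) (hl : LocallyIntegrable ϱ volume) (k : ℕ)
    (h0 : ∀ (φ : ContDiffBump (0 : ℝ)) (b : ℝ),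
      iteratedDeriv k (convolution (φ.normed volume) ϱ (ContinuousLinearMap.lsmul ℝ ℝ) volume) b = 0) :
    ∃ p : Polynomial ℝ, ϱ =ᵐ[volume] fun x => p.eval x := by
  let φ : ℕ → ContDiffBump (0 : ℝ) := fun n =>
    ⟨1 / ((n : ℝ) + 1) / 2, 1 / ((n : ℝ) + 1), by positivity, half_lt_self (by positivity)⟩
  have hφ : Tendsto (fun n => (φ n).rOut) atTop (𝓝 0) := tendsto_one_div_add_atTop_nhds_zero_nat
  have hae := ContDiffBump.ae_convolution_tendsto_right_of_locallyIntegrable (μ := volume)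
    (K := 2) hφ (Eventually.of_forall fun n => by simp only [φ]; linarith) hl
  set g : ℕ → ℝ → ℝ := fun n =>
    convolution ((φ n).normed volume) ϱ (ContinuousLinearMap.lsmul ℝ ℝ) volume with hg
  have hgs : ∀ n, ContDiff ℝ (⊤ : ℕ∞) (g n) := fun n =>
    HasCompactSupport.contDiff_convolution_left _ (φ n).hasCompactSupport_normed
      (φ n).contDiff_normed hl
  choose P hPd hP using fun n => poly_of_iteratedDeriv k (g n) (hgs n) (h0 (φ n))
  set T : Set ℝ := {x | Tendsto (fun n => g n x) atTop (𝓝 (ϱ x))} with hT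
  have hTae : ∀ᵐ x, x ∈ T := hae
  have hTinf : T.Infinite := by
    intro hfin
    have h1 := hfin.measure_zero (volume : Measure ℝ)
    have h2 : volume Tᶜ = 0 := hTae
    have h3 : volume (T ∪ Tᶜ) = 0 := measure_union_null h1 h2
    simp at h3
  obtain ⟨s, hsT, hsc⟩ := hTinf.exists_subset_card_eq k
  refine ⟨Lagrange.interpolate s id ϱ, ?_⟩
  filter_upwards [hTae] with x hx
  have e1 : ∀ n, g n x = ∑ i ∈ s, g n i * (Lagrange.basis s id i).eval x := by
    intro n
    have := Lagrange.eq_interpolate_of_eval_eq (s := s) (v := id) (g n) (f := P n)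
      (injOn_id _) (by rw [hsc]; exact hPd n) (fun i _ => (hP n i).symm)
    rw [hP n x, this, Lagrange.interpolate_apply, Polynomial.eval_finsetSum]
    simp
  have h2 : Tendsto (fun n => g n x) atTop
      (𝓝 (∑ i ∈ s, ϱ i * (Lagrange.basis s id i).eval x)) := by
    simp only [e1]
    exact tendsto_finsetSum _ fun i hi => (hsT hi : Tendsto _ _ _).mul_const _
  have h3 := tendsto_nhds_unique hx h2
  rw [h3, Lagrange.interpolate_apply, Polynomial.eval_finsetSum]
  simp

/-- The linear functional `x ↦ ⟨a, x⟩`. -/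
abbrev lf {d : ℕ} (a x : Fin d → ℝ) : ℝ := ∑ i, a i * x i

lemma lf_bound {d : ℕ} {Ω : Set (Fin d → ℝ)} (hΩ : Bornology.IsBounded Ω) (a : Fin d → ℝ) :
    ∃ B : ℝ, 0 ≤ B ∧ ∀ x ∈ Ω, |lf a x| ≤ B := by
  have hc : Continuous fun x : Fin d → ℝ => lf a x := by fun_prop
  obtain ⟨C, hC⟩ := hΩ.isCompact_closure.exists_bound_of_continuousOn hc.continuousOn
  exact ⟨|C|, abs_nonneg _, fun x hx => (hC x (subset_closure hx)).trans (le_abs_self _)⟩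

lemma aesm_of {ϱ : ℝ → ℝ} {U : Set ℝ} (hU : IsOpen U) (hc : ContinuousOn ϱ U) :
    Measurable (U.indicator ϱ) := by
  classical
  exact measurable_of_isOpen fun t ht => by
    obtain ⟨V, hV, hV'⟩ := (continuousOn_iff'.1 hc) t ht
    by_cases h0 : (0 : ℝ) ∈ t
    · have : U.indicator ϱ ⁻¹' t = (V ∩ U) ∪ Uᶜ := by
        rw [← hV']
        ext x
        by_cases hx : x ∈ U <;> simp [hx, h0]
      rw [this]
      exact (hV.measurableSet.inter hU.measurableSet).union hU.measurableSet.compl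
    · have : U.indicator ϱ ⁻¹' t = (V ∩ U) := by
        rw [← hV']
        ext x
        by_cases hx : x ∈ U <;> simp [hx, h0]
      rw [this]
      exact (hV.measurableSet.inter hU.measurableSet)

lemma gen_meas {d : ℕ} {ϱ : ℝ → ℝ} {U : Set ℝ} (hU : IsOpen U) (hU0 : volume Uᶜ = 0)
    (hc : ContinuousOn ϱ U) (a : Fin d → ℝ) (b : ℝ) :
    AEStronglyMeasurable (fun x => ϱ (lf a x + b)) volume := by
  by_cases ha : a = 0
  · simp [ha, lf, aestronglyMeasurable_const]
  · let L : (Fin d → ℝ) →ₗ[ℝ] ℝ := ∑ i, a i • LinearMap.proj i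
    have hL : ∀ x, L x = lf a x := fun x => by simp [L, lf]
    have hLs : Function.Surjective L := by
      refine LinearMap.surjective ?_
      intro h
      apply ha
      ext i
      have := hL (Pi.single i 1)
      rw [h] at this
      simpa [lf, Pi.single_apply] using this.symm
    have hae : ∀ᵐ y : ℝ, y + b ∈ U :=
      (measurePreserving_add_right volume b).quasiMeasurePreserving.ae (p := fun y => y ∈ U) hU0
    have hms : MeasurableSet {y : ℝ | y + b ∈ U} :=
      (measurable_id.add_const b) hU.measurableSet
    have h2 := (ae_comp_linearMap_mem_iff L (volume : Measure (Fin d → ℝ)) (volume : Measure ℝ)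
      hLs hms).2 hae
    refine ⟨fun x => U.indicator ϱ (lf a x + b), ?_, ?_⟩
    · apply Measurable.stronglyMeasurable
      exact (aesm_of hU hc).comp (by fun_prop)
    · filter_upwards [h2] with x hx
      have hx' : lf a x + b ∈ U := by rw [← hL]; exact hx
      simp [indicator_of_mem hx']

lemma loc_int {ϱ : ℝ → ℝ} {U : Set ℝ} (hU : IsOpen U) (hU0 : volume Uᶜ = 0)
    (hc : ContinuousOn ϱ U) (hb : ∀ a b : ℝ, ∃ M : ℝ, ∀ x ∈ Set.Icc a b, |ϱ x| ≤ M) :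
    LocallyIntegrable ϱ volume := by
  rw [locallyIntegrable_iff]
  intro K hK
  obtain ⟨R, hR⟩ := hK.isBounded.subset_closedBall 0
  obtain ⟨M, hM⟩ := hb (-R) R
  refine Measure.integrableOn_of_bounded (M := M) hK.measure_lt_top.ne ?_ ?_
  · refine ⟨U.indicator ϱ, (aesm_of hU hc).stronglyMeasurable, ?_⟩
    have : ∀ᵐ y : ℝ, y ∈ U := hU0
    filter_upwards [this] with x hx
    simp [indicator_of_mem hx]
  · refine (ae_restrict_mem hK.measurableSet).mono fun x hx => hM x ?_
    have := hR hx
    rw [Real.closedBall_eq_Icc] at this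
    simpa using this

section main
variable {d : ℕ} {Ω : Set (Fin d → ℝ)} {p : ENNReal}
  {S : Submodule ℝ ((Fin d → ℝ) → ℝ)}

lemma Appr.lim' (hΩm : MeasurableSet Ω) (hΩ : Bornology.IsBounded Ω) (hp0 : p ≠ 0) (hpt : p ≠ ⊤)
    {h : ℕ → (Fin d → ℝ) → ℝ} {k : (Fin d → ℝ) → ℝ}
    (C : ℝ) (hh : ∀ n, Appr (volume.restrict Ω) p S (h n)) (hb : ∀ n, ∀ x ∈ Ω, |h n x| ≤ C)
    (hl : ∀ x ∈ Ω, Tendsto (fun n => h n x) atTop (𝓝 (k x))) :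
    Appr (volume.restrict Ω) p S k := by
  have : IsFiniteMeasure (volume.restrict Ω) :=
    ⟨by simpa using hΩ.measure_lt_top⟩
  refine Appr.lim hp0 hpt C hh (fun n => ?_) ?_
  · exact (ae_restrict_mem hΩm).mono (hb n)
  · exact (ae_restrict_mem hΩm).mono hl

lemma appr_conv (hΩm : MeasurableSet Ω) (hΩ : Bornology.IsBounded Ω) (hp0 : p ≠ 0) (hpt : p ≠ ⊤)
    {ϱ : ℝ → ℝ} {U : Set ℝ} (hU : IsOpen U) (hU0 : volume Uᶜ = 0)
    (hc : ContinuousOn ϱ U) (hb : ∀ a b : ℝ, ∃ M : ℝ, ∀ x ∈ Set.Icc a b, |ϱ x| ≤ M)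
    (hS : ∀ a b, (fun x => ϱ (lf a x + b)) ∈ S) (φ : ContDiffBump (0 : ℝ))
    (a : Fin d → ℝ) (b : ℝ) :
    Appr (volume.restrict Ω) p S (fun x =>
      convolution (φ.normed volume) ϱ (ContinuousLinearMap.lsmul ℝ ℝ) volume (lf a x + b)) := by
  obtain ⟨B, hB0, hB⟩ := lf_bound hΩ a
  set r := φ.rOut with hr
  have hr0 : 0 < r := φ.rOut_pos
  obtain ⟨M, hM⟩ := hb (-(B + |b| + r)) (B + |b| + r)
  have hM0 : 0 ≤ M := (abs_nonneg _).trans (hM 0 ⟨by linarith [abs_nonneg b], by positivity⟩)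
  set ψ := φ.normed volume with hψ
  have hψc : Continuous ψ := φ.continuous_normed
  have hψ0 : ∀ t, t ∉ Ioo (-r) r → ψ t = 0 := by
    intro t ht
    have := φ.support_normed_eq (μ := volume)
    by_contra hne
    have h1 : t ∈ Function.support ψ := hne
    rw [this, Real.ball_eq_Ioo] at h1
    exact ht (by simpa using h1)
  obtain ⟨D, hD⟩ := hψc.bounded_above_of_compact_support φ.hasCompactSupport_normed
  have hD0 : 0 ≤ D := (norm_nonneg _).trans (hD 0)
  let F : ℝ → ℝ → ℝ := fun s u => (2 * r) * (ψ (2 * r * u + -r) * ϱ (s - (2 * r * u + -r)))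
  have hF : ∀ s, |s| ≤ B + |b| → ∀ u, |F s u| ≤ (2 * r) * (D * M) := by
    intro s hs u
    simp only [F, abs_mul, abs_of_pos hr0, abs_two]
    by_cases h : 2 * r * u + -r ∈ Ioo (-r) r
    · gcongr
      · exact hD _
      · apply hM
        have := abs_le.1 hs
        constructor <;> linarith [h.1, h.2]
    · rw [hψ0 _ h]; simp; positivity
  have hFc : ∀ s, ∀ᵐ u, ContinuousAt (F s) u := by
    intro s
    have h1 : ∀ᵐ t : ℝ, s - (t + -r) ∈ U := by
      have h2 : ∀ᵐ t : ℝ, s - t ∈ U :=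
        (Measure.measurePreserving_sub_left volume s).quasiMeasurePreserving.ae (p := fun y => y ∈ U) hU0
      exact (measurePreserving_add_right volume (-r)).quasiMeasurePreserving.ae
        (p := fun y => s - y ∈ U) h2
    have h3 : ∀ᵐ u : ℝ, s - (2 * r * u + -r) ∈ U := by
      have := Measure.addHaar_preimage_smul (volume : Measure ℝ) (r := 2 * r) (by positivity)
        {t : ℝ | s - (t + -r) ∈ U}ᶜ
      have h1' : volume {t : ℝ | s - (t + -r) ∈ U}ᶜ = 0 := h1
      rw [h1', mul_zero] at this
      exact this
    filter_upwards [h3] with u hu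
    have h4 : ContinuousAt ϱ (s - (2 * r * u + -r)) := hc.continuousAt (hU.mem_nhds hu)
    have h5 : ContinuousAt (fun u : ℝ => ϱ (s - (2 * r * u + -r))) u :=
      ContinuousAt.comp (g := ϱ) (f := fun u : ℝ => s - (2 * r * u + -r)) h4 (by fun_prop)
    have h6 : ContinuousAt (fun u : ℝ => ψ (2 * r * u + -r)) u := by fun_prop
    exact continuousAt_const.mul (h6.mul h5)
  have hconv : ∀ s, convolution ψ ϱ (ContinuousLinearMap.lsmul ℝ ℝ) volume s
      = ∫ u in (0:ℝ)..1, F s u := by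
    intro s
    simp only [F]
    rw [intervalIntegral.integral_const_mul,
      intervalIntegral.integral_comp_mul_add (fun t => ψ t * ϱ (s - t)) (by positivity) (-r)]
    rw [smul_eq_mul, ← mul_assoc, mul_inv_cancel₀ (by positivity), one_mul]
    rw [intervalIntegral.integral_of_le (by linarith),
      setIntegral_eq_integral_of_forall_compl_eq_zero]
    · simp [convolution]
    · intro t ht
      rw [hψ0, zero_mul]
      intro h
      exact ht ⟨by linarith [h.1], by linarith [h.2]⟩
  have hsb : ∀ x ∈ Ω, |lf a x + b| ≤ B + |b| := fun x hx =>
    (abs_add_le _ _).trans (by linarith [hB x hx])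
  refine Appr.lim' hΩm hΩ hp0 hpt (h := fun n x => ∑ i ∈ Finset.range (n + 1),
    (1 / ((n : ℝ) + 1)) * F (lf a x + b) (i / ((n : ℝ) + 1))) ((2 * r) * (D * M)) ?_ ?_ ?_
  · intro n
    have := Appr.sum (μ := volume.restrict Ω) (p := p) (S := S) (Finset.range (n + 1))
      (h := fun i x => (1 / ((n : ℝ) + 1)) * F (lf a x + b) (i / ((n : ℝ) + 1))) ?_
    · convert this using 1
      ext x
      simp
    · intro i _
      have h1 := (Appr.of_mem (p := p) (hS a (b - (2 * r * (i / ((n : ℝ) + 1)) + -r)))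
        (gen_meas hU hU0 hc _ _).restrict (μ := volume.restrict Ω)).smul
        ((1 / ((n : ℝ) + 1)) * ((2 * r) * (ψ (2 * r * (i / ((n : ℝ) + 1)) + -r))))
      convert h1 using 1
      ext x
      simp only [F, Pi.smul_apply, smul_eq_mul, add_sub_assoc]
      ring
  · intro n x hx
    have hn : (0 : ℝ) < (n : ℝ) + 1 := by positivity
    refine (Finset.abs_sum_le_sum_abs _ _).trans ?_
    calc _ ≤ ∑ i ∈ Finset.range (n + 1), (1 / ((n : ℝ) + 1)) * ((2 * r) * (D * M)) := by
          refine Finset.sum_le_sum fun i _ => ?_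
          rw [abs_mul, abs_of_pos (by positivity : 0 < 1 / ((n : ℝ) + 1))]
          exact mul_le_mul_of_nonneg_left (hF _ (hsb x hx) _) (by positivity)
      _ = _ := by
          rw [Finset.sum_const, Finset.card_range, nsmul_eq_mul]
          push_cast
          field_simp
      _ ≤ _ := le_rfl
  · intro x hx
    rw [hconv]
    exact riemann _ _ (hF _ (hsb x hx)) (hFc _)

lemma appr_deriv (hΩm : MeasurableSet Ω) (hΩ : Bornology.IsBounded Ω) (hp0 : p ≠ 0) (hpt : p ≠ ⊤)
    {g : ℝ → ℝ} (hg : ContDiff ℝ (⊤ : ℕ∞) g)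
    (H : ∀ a b, Appr (volume.restrict Ω) p S (fun x => g (lf a x + b))) (a : Fin d → ℝ) (b : ℝ)
    (k : ℕ) : ∀ c : ℝ,
    Appr (volume.restrict Ω) p S (fun x => (lf a x) ^ k * iteratedDeriv k g (c * lf a x + b)) := by
  induction k with
  | zero =>
    intro c
    convert H (c • a) b using 1
    ext x
    simp [lf, Finset.mul_sum, mul_assoc]
  | succ k ih =>
    intro c
    obtain ⟨B, hB0, hB⟩ := lf_bound hΩ a
    have hdiff : Differentiable ℝ (iteratedDeriv k g) :=
      hg.differentiable_iteratedDeriv k (by exact_mod_cast ENat.natCast_lt_top k)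
    have hcont : Continuous (iteratedDeriv (k + 1) g) :=
      hg.continuous_iteratedDeriv (k + 1) (by exact_mod_cast le_top)
    set Q : ℝ := (|c| + 1) * B + |b| with hQ
    obtain ⟨D, hD⟩ := (isCompact_Icc (a := -Q) (b := Q)).exists_bound_of_continuousOn
      hcont.continuousOn
    have hQ0 : 0 ≤ Q := by positivity
    have hD0 : 0 ≤ D := (norm_nonneg _).trans (hD 0 ⟨by linarith, hQ0⟩)
    have hmem : ∀ x ∈ Ω, ∀ e : ℝ, |e| ≤ |c| + 1 → e * lf a x + b ∈ Icc (-Q) Q := by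
      intro x hx e he
      rw [mem_Icc, ← abs_le]
      refine (abs_add_le _ _).trans ?_
      rw [abs_mul, hQ]
      gcongr
      exact hB x hx
    refine Appr.lim' hΩm hΩ hp0 hpt (h := fun (n : ℕ) x => ((n : ℝ) + 1) *
      ((lf a x) ^ k * iteratedDeriv k g ((c + 1 / ((n : ℝ) + 1)) * lf a x + b)
        - (lf a x) ^ k * iteratedDeriv k g (c * lf a x + b))) (B ^ k * (D * B)) ?_ ?_ ?_
    · intro n
      exact ((ih (c + 1 / ((n : ℝ) + 1))).sub (ih c)).smul ((n : ℝ) + 1)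
    · intro n x hx
      have hn : (0 : ℝ) < (n : ℝ) + 1 := by positivity
      have h1 : (1 : ℝ) / ((n : ℝ) + 1) ≤ 1 := by
        rw [div_le_one hn]; linarith [(Nat.cast_nonneg n : (0 : ℝ) ≤ n)]
      have h2 := Convex.norm_image_sub_le_of_norm_deriv_le (f := iteratedDeriv k g)
        (s := Icc (-Q) Q) (C := D) (fun y _ => hdiff y)
        (fun y hy => by rw [← iteratedDeriv_succ]; exact hD y hy) (convex_Icc _ _)
        (hmem x hx c (by linarith))
        (hmem x hx (c + 1 / ((n : ℝ) + 1)) ((abs_add_le _ _).trans (by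
          rw [abs_of_pos (by positivity : 0 < 1 / ((n : ℝ) + 1))]; linarith)))
      rw [← mul_sub, abs_mul, abs_mul, abs_of_pos hn, abs_pow]
      have e1 : (c + 1 / ((n : ℝ) + 1)) * lf a x + b - (c * lf a x + b)
          = 1 / ((n : ℝ) + 1) * lf a x := by ring
      rw [e1, Real.norm_eq_abs, Real.norm_eq_abs, abs_mul,
        abs_of_pos (by positivity : 0 < 1 / ((n : ℝ) + 1))] at h2
      calc _ ≤ ((n : ℝ) + 1) * (|lf a x| ^ k * (D * (1 / ((n : ℝ) + 1) * |lf a x|))) := by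
            gcongr
        _ = |lf a x| ^ k * (D * |lf a x|) := by field_simp
        _ ≤ _ := by gcongr <;> exact hB x hx
    · intro x hx
      have hd : HasDerivAt (fun t : ℝ => (lf a x) ^ k * iteratedDeriv k g (t * lf a x + b))
          ((lf a x) ^ k * (iteratedDeriv (k + 1) g (c * lf a x + b) * lf a x)) c := by
        have h1 : HasDerivAt (iteratedDeriv k g) (iteratedDeriv (k + 1) g (c * lf a x + b))
            (c * lf a x + b) := by
          rw [iteratedDeriv_succ]; exact (hdiff _).hasDerivAt
        have h2 : HasDerivAt (fun t : ℝ => t * lf a x + b) (lf a x) c := by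
          simpa using ((hasDerivAt_id c).mul_const (lf a x)).add_const b
        exact (h1.comp c h2).const_mul _
      rw [hasDerivAt_iff_tendsto_slope_zero] at hd
      have h3 : Tendsto (fun n : ℕ => 1 / ((n : ℝ) + 1)) atTop (𝓝[≠] 0) := by
        refine tendsto_nhdsWithin_iff.2 ⟨tendsto_one_div_add_atTop_nhds_zero_nat, ?_⟩
        refine Eventually.of_forall fun n => ?_
        have : (1 : ℝ) / ((n : ℝ) + 1) ≠ 0 := by positivity
        exact this
      have h4 := hd.comp h3
      convert h4 using 1
      · ext n
        simp
      · congr 1; ring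

lemma appr_exp (hΩm : MeasurableSet Ω) (hΩ : Bornology.IsBounded Ω) (hp0 : p ≠ 0) (hpt : p ≠ ⊤)
    (a : Fin d → ℝ) (H : ∀ k : ℕ, Appr (volume.restrict Ω) p S (fun x => (lf a x) ^ k)) :
    Appr (volume.restrict Ω) p S (fun x => Real.exp (lf a x)) := by
  obtain ⟨B, hB0, hB⟩ := lf_bound hΩ a
  refine Appr.lim' hΩm hΩ hp0 hpt (h := fun (n : ℕ) x => ∑ i ∈ Finset.range n,
    (lf a x) ^ i / (i.factorial : ℝ)) (Real.exp B) ?_ ?_ ?_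
  · intro n
    have := Appr.sum (μ := volume.restrict Ω) (p := p) (S := S) (Finset.range n)
      (fun i _ => (H i).smul ((i.factorial : ℝ)⁻¹))
    convert this using 1
    ext x
    simp [div_eq_inv_mul]
  · intro n x hx
    refine (Finset.abs_sum_le_sum_abs _ _).trans ?_
    refine le_trans ?_ (Real.sum_le_exp_of_nonneg hB0 n)
    refine Finset.sum_le_sum fun i _ => ?_
    rw [abs_div, abs_pow, Nat.abs_cast]
    gcongr
    exact hB x hx
  · intro x _
    have := (NormedSpace.expSeries_div_hasSum_exp (lf a x)).tendsto_sum_nat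
    rwa [← Real.exp_eq_exp_ℝ] at this

lemma appr_cont (hΩm : MeasurableSet Ω) (hΩ : Bornology.IsBounded Ω) (hp0 : p ≠ 0) (hpt : p ≠ ⊤)
    (H : ∀ a, Appr (volume.restrict Ω) p S (fun x => Real.exp (lf a x)))
    (f : C(Fin d → ℝ, ℝ)) : Appr (volume.restrict Ω) p S f := by
  let e : (Fin d → ℝ) → C(Fin d → ℝ, ℝ) := fun a => ⟨fun x => Real.exp (lf a x), by fun_prop⟩
  let A : Subalgebra ℝ C(Fin d → ℝ, ℝ) := Algebra.adjoin ℝ (range e)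
  have hA : ∀ g ∈ A, Appr (volume.restrict Ω) p S g := by
    intro g hg
    have hg' : g ∈ Subalgebra.toSubmodule A := hg
    rw [Algebra.adjoin_eq_span] at hg'
    have hcl : ∀ g ∈ Submonoid.closure (range e), ∃ a, g = e a := by
      intro g hg
      induction hg using Submonoid.closure_induction with
      | mem x hx => obtain ⟨a, rfl⟩ := hx; exact ⟨a, rfl⟩
      | one => exact ⟨0, by ext x; simp [e, lf]⟩
      | mul x y _ _ hx hy =>
        obtain ⟨a, rfl⟩ := hx
        obtain ⟨b, rfl⟩ := hy
        exact ⟨a + b, by ext x; simp [e, lf, add_mul, Finset.sum_add_distrib, Real.exp_add]⟩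
    induction hg' using Submodule.span_induction with
    | mem x hx => obtain ⟨a, rfl⟩ := hcl x hx; exact H a
    | zero => exact Appr.zero
    | add x y hx hy h1 h2 =>
      have h1 := h1 (by
        have : x ∈ Subalgebra.toSubmodule A := by rw [Algebra.adjoin_eq_span]; exact hx
        exact this)
      have h2 := h2 (by
        have : y ∈ Subalgebra.toSubmodule A := by rw [Algebra.adjoin_eq_span]; exact hy
        exact this)
      exact h1.add h2
    | smul c x hx h1 =>
      have h1 := h1 (by
        have : x ∈ Subalgebra.toSubmodule A := by rw [Algebra.adjoin_eq_span]; exact hx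
        exact this)
      exact h1.smul c
  have hsep : A.SeparatesPoints := by
    intro x y hxy
    obtain ⟨i, hi⟩ := Function.ne_iff.1 hxy
    refine ⟨e (Pi.single i 1), ⟨e (Pi.single i 1), Algebra.subset_adjoin ⟨_, rfl⟩, rfl⟩, ?_⟩
    simpa [e, lf, Pi.single_apply] using hi
  choose g hgA hg using fun n : ℕ =>
    ContinuousMap.exists_mem_subalgebra_near_continuous_of_isCompact_of_separatesPoints hsep f
      hΩ.isCompact_closure (ε := 1 / ((n : ℝ) + 1)) (by positivity)
  obtain ⟨C, hC⟩ := hΩ.isCompact_closure.exists_bound_of_continuousOn f.continuous.continuousOn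
  refine Appr.lim' hΩm hΩ hp0 hpt (h := fun n => g n) (1 + C) (fun n => hA _ (hgA n)) ?_ ?_
  · intro n x hx
    have h1 := hg n x (subset_closure hx)
    have h2 := hC x (subset_closure hx)
    have hn : (0 : ℝ) < (n : ℝ) + 1 := by positivity
    have h3 : (1 : ℝ) / ((n : ℝ) + 1) ≤ 1 := by
      rw [div_le_one hn]; linarith [(Nat.cast_nonneg n : (0 : ℝ) ≤ n)]
    have h4 := abs_add_le (g n x - f x) (f x)
    rw [sub_add_cancel] at h4
    rw [Real.norm_eq_abs] at h1 h2
    linarith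
  · intro x hx
    rw [tendsto_iff_norm_sub_tendsto_zero]
    exact squeeze_zero (fun _ => norm_nonneg _) (fun n => (hg n x (subset_closure hx)).le)
      tendsto_one_div_add_atTop_nhds_zero_nat

end main

end NNDense

theorem stmt_14 (d : ℕ) (ϱ : ℝ → ℝ)
    (ha : ∃ U : Set ℝ, IsOpen U ∧ volume Uᶜ = 0 ∧ ContinuousOn ϱ U)
    (hb : ∀ a b : ℝ, ∃ M : ℝ, ∀ x ∈ Set.Icc a b, |ϱ x| ≤ M)
    (hc : ¬ ∃ p : Polynomial ℝ, ϱ =ᵐ[volume] fun x => p.eval x)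
    (Ω : Set (Fin d → ℝ)) (hΩb : Bornology.IsBounded Ω) (hΩm : MeasurableSet Ω)
    (p : ℝ) (hp : 0 < p)
    (f : (Fin d → ℝ) → ℝ) (hf : Measurable f)
    (hfLp : Integrable (fun x => |f x| ^ p) (volume.restrict Ω))
    (ε : ℝ) (hε : 0 < ε) :
    ∃ g ∈ Submodule.span ℝ
        {h : (Fin d → ℝ) → ℝ | ∃ (a : Fin d → ℝ) (b : ℝ),
          h = fun x => ϱ (∑ i, a i * x i + b)},
      (∫ x in Ω, |f x - g x| ^ p) < ε ^ p := by
  obtain ⟨U, hU, hU0, hcont⟩ := ha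
  set S := Submodule.span ℝ
        {h : (Fin d → ℝ) → ℝ | ∃ (a : Fin d → ℝ) (b : ℝ),
          h = fun x => ϱ (∑ i, a i * x i + b)} with hSdef
  have hS : ∀ a b, (fun x => ϱ (NNDense.lf a x + b)) ∈ S :=
    fun a b => Submodule.subset_span ⟨a, b, rfl⟩
  set q : ENNReal := ENNReal.ofReal p with hq
  have hq0 : q ≠ 0 := by simpa [hq] using hp
  have hqt : q ≠ ⊤ := ENNReal.ofReal_ne_top
  have hqr : q.toReal = p := ENNReal.toReal_ofReal hp.le
  have hloc := NNDense.loc_int hU hU0 hcont hb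
  have hmono : ∀ (a : Fin d → ℝ) (k : ℕ),
      NNDense.Appr (volume.restrict Ω) q S (fun x => (NNDense.lf a x) ^ k) := by
    intro a k
    have hex : ∃ (φ : ContDiffBump (0 : ℝ)) (b : ℝ), iteratedDeriv k
        (convolution (φ.normed volume) ϱ (ContinuousLinearMap.lsmul ℝ ℝ) volume) b ≠ 0 := by
      by_contra hne
      push Not at hne
      exact hc (NNDense.ae_poly ϱ hloc k hne)
    obtain ⟨φ, b, hφb⟩ := hex
    have h1 := NNDense.appr_deriv hΩm hΩb hq0 hqt
      (HasCompactSupport.contDiff_convolution_left (n := ⊤) (ContinuousLinearMap.lsmul ℝ ℝ)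
        (φ.hasCompactSupport_normed (μ := volume)) φ.contDiff_normed hloc)
      (NNDense.appr_conv hΩm hΩb hq0 hqt hU hU0 hcont hb hS φ) a b k 0
    have h2 := h1.smul (iteratedDeriv k
        (convolution (φ.normed volume) ϱ (ContinuousLinearMap.lsmul ℝ ℝ) volume) b)⁻¹
    convert h2 using 1
    ext x
    simp only [Pi.smul_apply, smul_eq_mul, zero_mul, zero_add]
    field_simp
  have hcontA := NNDense.appr_cont hΩm hΩb hq0 hqt
    (fun a => NNDense.appr_exp hΩm hΩb hq0 hqt a (hmono a))
  have hfm : AEStronglyMeasurable f (volume.restrict Ω) := hf.aestronglyMeasurable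
  have hfM : MemLp f q (volume.restrict Ω) := by
    rw [← integrable_norm_rpow_iff hfm hq0 hqt, hqr]
    exact hfLp
  have : IsFiniteMeasure (volume.restrict Ω) :=
    ⟨by simpa using hΩb.measure_lt_top⟩
  have hfA : NNDense.Appr (volume.restrict Ω) q S f := by
    refine NNDense.Appr.of_near hfm fun δ hδ => ?_
    obtain ⟨g, hg, -⟩ := hfM.exists_boundedContinuous_eLpNorm_sub_le hqt hδ
    exact ⟨g, hcontA g.toContinuousMap, hg⟩
  obtain ⟨g, hgS, hgm, hg⟩ := hfA.2 (ENNReal.ofReal ε) (by simpa using hε)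
  refine ⟨g, hgS, ?_⟩
  have hmem : MemLp (f - g) q (volume.restrict Ω) :=
    ⟨hfm.sub hgm, hg.trans ENNReal.ofReal_lt_top⟩
  rw [hmem.eLpNorm_eq_integral_rpow_norm hq0 hqt, hqr, ENNReal.ofReal_lt_ofReal_iff hε] at hg
  have hnn : 0 ≤ ∫ x in Ω, ‖(f - g) x‖ ^ p := integral_nonneg fun x => by positivity
  have := (Real.rpow_inv_lt_iff_of_pos hnn hε.le hp).1 hg
  simpa [Real.norm_eq_abs] using this
end

section
/- For every r ∈ ℕ ∪ {0}, β^{(r+1)} = β^{(r)} * χ_{[0,1]}, i.e. β^{(r+1)}(x) = ∫_ℝ β^{(r)}(x − y) χ_{[0,1]}(y) dy for all x ∈ ℝ. -/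
/-- ϱ_r(x) = max{0, x}^r. -/
noncomputable def rhoPow (r : ℕ) (x : ℝ) : ℝ := max 0 x ^ r

/-- The B-splines: β⁰ = χ_{(0,1]} and
β^{(r)}(x) = (1/r!) Σ_{k=0}^{r+1} C(r+1,k)(−1)^k ϱ_r(x − k) for r ≥ 1. -/
noncomputable def bspline : ℕ → ℝ → ℝ
  | 0 => Set.indicator (Set.Ioc (0 : ℝ) 1) (fun _ => (1 : ℝ))
  | r + 1 => fun x => (1 / (Nat.factorial (r + 1) : ℝ)) *
      ∑ k ∈ Finset.range (r + 3), ((r + 2).choose k : ℝ) * (-1) ^ k * rhoPow (r + 1) (x - k)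

/-- truncated power with value 0 at nonpositive points, also for r = 0 -/
noncomputable def hpow (r : ℕ) (x : ℝ) : ℝ := if 0 < x then x ^ r else 0

lemma hpow_succ (r : ℕ) (x : ℝ) : rhoPow (r + 1) x = hpow (r + 1) x := by
  unfold rhoPow hpow
  split_ifs with h
  · rw [max_eq_right h.le]
  · rw [max_eq_left (not_lt.mp h)]; simp

lemma bspline_eq (r : ℕ) (x : ℝ) : bspline r x = (1 / (Nat.factorial r : ℝ)) *
    ∑ k ∈ Finset.range (r + 2), ((r + 1).choose k : ℝ) * (-1) ^ k * hpow r (x - k) := by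
  cases r with
  | zero =>
    simp only [bspline, hpow, Finset.sum_range_succ, Set.indicator, Set.mem_Ioc]
    by_cases h0 : 0 < x <;> by_cases h1 : x ≤ 1
    · simp [h0, h1]
    · simp [h0, h1, not_le.mp h1]
    · simp [h0, h1]
    · exfalso; linarith
  | succ r => simp only [bspline, hpow_succ]

lemma hpow_mono (r : ℕ) : Monotone (hpow r) := by
  intro a b hab
  unfold hpow
  split_ifs with h1 h2 h2
  · exact pow_le_pow_left₀ h1.le hab r
  · linarith
  · positivity
  · exact le_rfl

lemma hpow_int (r : ℕ) (a b : ℝ) :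
    ∫ y in a..b, hpow r y = (hpow (r + 1) b - hpow (r + 1) a) / (r + 1) := by
  have hr : (r : ℝ) + 1 ≠ 0 := by positivity
  rw [MeasureTheory.integral_eq_of_hasDerivAt_off_countable
    (fun y => hpow (r + 1) y / (r + 1)) (hpow r) (Set.countable_singleton (0 : ℝ))]
  · ring
  · have : (fun y : ℝ => hpow (r + 1) y / (r + 1)) = fun y : ℝ => max 0 y ^ (r + 1) / ((r : ℝ) + 1) := by
      funext y; rw [← hpow_succ]; rfl
    rw [this]
    fun_prop
  · intro y hy
    have hy0 : y ≠ 0 := by simpa using hy.2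
    rcases lt_or_gt_of_ne hy0 with h | h
    · have : hpow r y = 0 := by simp [hpow, not_lt.mpr h.le]
      rw [this]
      refine (hasDerivAt_const y (0 : ℝ)).congr_of_eventuallyEq ?_
      filter_upwards [gt_mem_nhds h] with z hz
      simp [hpow, not_lt.mpr hz.le]
    · have h2 : HasDerivAt (fun z : ℝ => z ^ (r + 1) / (r + 1)) (hpow r y) y := by
        have hv : hpow r y = ((r + 1 : ℕ) : ℝ) * y ^ (r + 1 - 1) / ((r : ℝ) + 1) := by
          rw [hpow, if_pos h, Nat.add_sub_cancel]
          push_cast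
          field_simp
        rw [hv]
        exact (hasDerivAt_pow (r + 1) y).div_const ((r : ℝ) + 1)
      refine h2.congr_of_eventuallyEq ?_
      filter_upwards [lt_mem_nhds h] with z hz
      simp [hpow, hz]
  · exact (hpow_mono r).intervalIntegrable

lemma pascal_sum (n : ℕ) (g : ℕ → ℝ) :
    ∑ k ∈ Finset.range (n + 1), (n.choose k : ℝ) * (-1) ^ k * (g k - g (k + 1)) =
    ∑ k ∈ Finset.range (n + 2), ((n + 1).choose k : ℝ) * (-1) ^ k * g k := by
  have h : ∑ k ∈ Finset.range (n + 1), (n.choose k : ℝ) * (-1) ^ k * g k =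
      ∑ k ∈ Finset.range (n + 1), (n.choose (k + 1) : ℝ) * (-1) ^ (k + 1) * g (k + 1) + g 0 := by
    have := Finset.sum_range_succ (fun k => (n.choose k : ℝ) * (-1) ^ k * g k) (n + 1)
    rw [Finset.sum_range_succ'] at this
    simpa using this.symm
  rw [Finset.sum_range_succ' _ (n + 1)]
  simp only [mul_sub, Finset.sum_sub_distrib]
  rw [h, add_sub_right_comm, ← Finset.sum_sub_distrib]
  congr 1
  · refine Finset.sum_congr rfl fun k _ => ?_
    rw [Nat.choose_succ_succ]
    push_cast
    ring
  · simp

/-- β^{(r+1)} = β^{(r)} * χ_{[0,1]}. -/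
theorem stmt_15 (r : ℕ) (x : ℝ) :
    bspline (r + 1) x =
      ∫ y, bspline r (x - y) * Set.indicator (Set.Icc (0 : ℝ) 1) (fun _ => (1 : ℝ)) y := by
  have h1 : (fun y => bspline r (x - y) * Set.indicator (Set.Icc (0 : ℝ) 1) (fun _ => (1 : ℝ)) y)
      = Set.indicator (Set.Icc (0 : ℝ) 1) (fun y => bspline r (x - y)) := by
    funext y
    by_cases hy : y ∈ Set.Icc (0 : ℝ) 1 <;> simp [Set.indicator, hy]
  rw [h1, MeasureTheory.integral_indicator measurableSet_Icc,
    MeasureTheory.integral_Icc_eq_integral_Ioc, ← intervalIntegral.integral_of_le zero_le_one]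
  simp only [bspline_eq]
  rw [intervalIntegral.integral_const_mul, intervalIntegral.integral_finsetSum]
  · have h2 : ∀ k : ℕ, ∫ y in (0 : ℝ)..1, ((r + 1).choose k : ℝ) * (-1) ^ k * hpow r (x - y - k)
        = ((r + 1).choose k : ℝ) * (-1) ^ k *
          (hpow (r + 1) (x - k) - hpow (r + 1) (x - (k + 1 : ℕ))) / (r + 1) := by
      intro k
      rw [intervalIntegral.integral_const_mul]
      have h3 : ∀ y : ℝ, x - y - k = (x - k) - y := fun y => by ring
      simp only [h3]
      rw [intervalIntegral.integral_comp_sub_left (fun y => hpow r y), hpow_int]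
      push_cast
      rw [sub_zero, sub_sub]
      ring
    simp only [h2]
    rw [← Finset.sum_div, pascal_sum (r + 1) (fun k => hpow (r + 1) (x - k)), Nat.factorial_succ]
    push_cast
    field_simp
  · intro k _
    refine IntervalIntegrable.const_mul ?_ _
    refine Antitone.intervalIntegrable ?_
    intro a b hab
    exact hpow_mono r (by linarith)
end
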